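/- For every δ₀ > 0 there exist constants C(δ₀) > 0 and ε̄(δ₀) > 0 such that for every nonempty finite set X, all distributions p, q on X, and every ε with 0 < ε ≤ min(d_TV(p,q)/4, ε̄(δ₀)) and (2+δ₀)ε < 1: n*_Sub(p,q,ε) ≤ n*_TV(p,q,ε) and n*_TV(p,q,ε) ≤ C(δ₀)·n*_Sub(p,q,(2+δ₀)ε). -/

import Mathlib

open scoped Classical ENNReal
open Finset

noncomputable section

/-- A probability distribution on a finite set. -/
def IsDist {X : Type*} [Fintype X] (p : X → ℝ) : Prop :=
  (∀ x, 0 ≤ p x) ∧ ∑ x, p x = 1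

/-- Total variation distance. -/
def dTV {X : Type*} [Fintype X] (p q : X → ℝ) : ℝ :=
  (1 / 2) * ∑ x, |p x - q x|

/-- Squared Hellinger divergence (also for unnormalized nonnegative vectors). -/
def hellSq {X : Type*} [Fintype X] (p q : X → ℝ) : ℝ :=
  ∑ x, (Real.sqrt (p x) - Real.sqrt (q x)) ^ 2

/-- ε-Huber uncertainty set. -/
def PHub {X : Type*} [Fintype X] (p : X → ℝ) (ε : ℝ) : Set (X → ℝ) :=
  {p' | IsDist p' ∧ ∀ x, (1 - ε) * p x ≤ p' x}

/-- ε-TV uncertainty set. -/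
def PTV {X : Type*} [Fintype X] (p : X → ℝ) (ε : ℝ) : Set (X → ℝ) :=
  {p' | IsDist p' ∧ dTV p' p ≤ ε}

/-- ε-subtractive uncertainty set. -/
def PSub {X : Type*} [Fintype X] (p : X → ℝ) (ε : ℝ) : Set (X → ℝ) :=
  {p' | IsDist p' ∧ ∀ x, p' x ≤ (1 + ε) * p x}

/-- Sum of worst-case type-I and type-II errors of a randomized test `φ` on `n`
i.i.d. samples, for composite hypotheses `Pcal` vs `Qcal`. -/
def errSum {X : Type*} [Fintype X] (Pcal Qcal : Set (X → ℝ)) (n : ℕ)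
    (φ : (Fin n → X) → ℝ) : ℝ :=
  (⨆ P : Pcal, ∑ x : Fin n → X, (∏ i, (P : X → ℝ) (x i)) * φ x) +
  (⨆ Q : Qcal, ∑ x : Fin n → X, (∏ i, (Q : X → ℝ) (x i)) * (1 - φ x))

/-- Minimax `n`-sample error for testing `Pcal` against `Qcal`. -/
def eStar {X : Type*} [Fintype X] (Pcal Qcal : Set (X → ℝ)) (n : ℕ) : ℝ :=
  ⨅ φ : {φ : (Fin n → X) → ℝ // ∀ x, 0 ≤ φ x ∧ φ x ≤ 1}, errSum Pcal Qcal n φ.1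

/-- Sample complexity: the least `n` with minimax error at most `1/10` (`⊤` if none). -/
def nStar {X : Type*} [Fintype X] (Pcal Qcal : Set (X → ℝ)) : ℝ≥0∞ :=
  sInf {N : ℝ≥0∞ | ∃ n : ℕ, N = (n : ℝ≥0∞) ∧ eStar Pcal Qcal n ≤ 1 / 10}

/-- Hellinger affinity. -/
def affinity {X : Type*} [Fintype X] (p q : X → ℝ) : ℝ :=
  ∑ x, √(p x) * √(q x)

section Tests

variable {X : Type*} [Fintype X]

lemma IsDist.le_one {p : X → ℝ} (hp : IsDist p) (x : X) : p x ≤ 1 := by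
  rw [← hp.2]
  exact Finset.single_le_sum (fun y _ => hp.1 y) (Finset.mem_univ x)

lemma IsDist.sum_prod_eq_one {p : X → ℝ} (hp : IsDist p) (n : ℕ) :
    ∑ x : Fin n → X, ∏ i, p (x i) = 1 := by
  rw [← Fintype.sum_pow, hp.2, one_pow]

lemma IsDist.prod_nonneg {p : X → ℝ} (hp : IsDist p) {n : ℕ} (x : Fin n → X) :
    0 ≤ ∏ i, p (x i) :=
  Finset.prod_nonneg fun i _ => hp.1 (x i)

lemma IsDist.expect_nonneg {p : X → ℝ} (hp : IsDist p) {n : ℕ} {φ : (Fin n → X) → ℝ}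
    (hφ : ∀ x, 0 ≤ φ x) : 0 ≤ ∑ x : Fin n → X, (∏ i, p (x i)) * φ x :=
  Finset.sum_nonneg fun x _ => mul_nonneg (hp.prod_nonneg x) (hφ x)

lemma IsDist.expect_le_one {p : X → ℝ} (hp : IsDist p) {n : ℕ} {φ : (Fin n → X) → ℝ}
    (hφ : ∀ x, φ x ≤ 1) : ∑ x : Fin n → X, (∏ i, p (x i)) * φ x ≤ 1 := by
  rw [← hp.sum_prod_eq_one n]
  exact Finset.sum_le_sum fun x _ => mul_le_of_le_one_right (hp.prod_nonneg x) (hφ x)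

lemma bddAbove_expect {S : Set (X → ℝ)} (hS : ∀ P ∈ S, IsDist P) {n : ℕ}
    {φ : (Fin n → X) → ℝ} (hφ : ∀ x, φ x ≤ 1) :
    BddAbove (Set.range fun P : S => ∑ x : Fin n → X, (∏ i, (P : X → ℝ) (x i)) * φ x) := by
  refine ⟨1, ?_⟩
  rintro _ ⟨P, rfl⟩
  exact (hS P P.2).expect_le_one hφ

lemma errSum_nonneg {S T : Set (X → ℝ)} (hS : ∀ P ∈ S, IsDist P) (hT : ∀ Q ∈ T, IsDist Q)
    {n : ℕ} {φ : (Fin n → X) → ℝ} (hφ : ∀ x, 0 ≤ φ x ∧ φ x ≤ 1) :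
    0 ≤ errSum S T n φ :=
  add_nonneg
    (Real.iSup_nonneg fun P => (hS P P.2).expect_nonneg fun x => (hφ x).1)
    (Real.iSup_nonneg fun Q => (hT Q Q.2).expect_nonneg
      (φ := fun x => 1 - φ x) fun x => sub_nonneg.2 (hφ x).2)

lemma eStar_le_errSum {S T : Set (X → ℝ)} (hS : ∀ P ∈ S, IsDist P) (hT : ∀ Q ∈ T, IsDist Q)
    {n : ℕ} {φ : (Fin n → X) → ℝ} (hφ : ∀ x, 0 ≤ φ x ∧ φ x ≤ 1) :
    eStar S T n ≤ errSum S T n φ := by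
  refine ciInf_le (f := fun φ : {φ : (Fin n → X) → ℝ // ∀ x, 0 ≤ φ x ∧ φ x ≤ 1} =>
    errSum S T n φ.1) ⟨0, ?_⟩ ⟨φ, hφ⟩
  rintro _ ⟨ψ, rfl⟩
  exact errSum_nonneg hS hT ψ.2

instance nonempty_test (n : ℕ) :
    Nonempty {φ : (Fin n → X) → ℝ // ∀ x, 0 ≤ φ x ∧ φ x ≤ 1} :=
  ⟨⟨fun _ => 0, fun _ => ⟨le_rfl, zero_le_one⟩⟩⟩

lemma eStar_mono {S S' T T' : Set (X → ℝ)} (hS' : ∀ P ∈ S', IsDist P)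
    (hT' : ∀ Q ∈ T', IsDist Q) (hne : S.Nonempty) (hne' : T.Nonempty)
    (hS : S ⊆ S') (hT : T ⊆ T') (n : ℕ) : eStar S T n ≤ eStar S' T' n := by
  refine le_ciInf fun φ => (eStar_le_errSum (fun P hP => hS' P (hS hP))
    (fun Q hQ => hT' Q (hT hQ)) φ.2).trans ?_
  have := hne.to_subtype
  have := hne'.to_subtype
  refine add_le_add (ciSup_le fun P => ?_) (ciSup_le fun Q => ?_)
  · exact le_ciSup (bddAbove_expect hS' fun x => (φ.2 x).2) ⟨P.1, hS P.2⟩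
  · exact le_ciSup (bddAbove_expect (φ := fun x => 1 - φ.1 x) hT'
      fun x => sub_le_self _ (φ.2 x).1) ⟨Q.1, hT Q.2⟩

lemma nStar_mono {S S' T T' : Set (X → ℝ)} (hS' : ∀ P ∈ S', IsDist P)
    (hT' : ∀ Q ∈ T', IsDist Q) (hne : S.Nonempty) (hne' : T.Nonempty)
    (hS : S ⊆ S') (hT : T ⊆ T') : nStar S T ≤ nStar S' T' := by
  refine sInf_le_sInf ?_
  rintro _ ⟨n, rfl, hn⟩
  exact ⟨n, rfl, (eStar_mono hS' hT' hne hne' hS hT n).trans hn⟩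

/-- Cauchy–Schwarz bound of the Hellinger affinity by the overlap `∑ min`. -/
lemma affinity_sq_le_two_mul_sum_min {p q : X → ℝ} (hp : IsDist p) (hq : IsDist q) :
    affinity p q ^ 2 ≤ 2 * ∑ x, min (p x) (q x) := by
  have h1 : affinity p q = ∑ x, √(min (p x) (q x)) * √(max (p x) (q x)) := by
    refine Finset.sum_congr rfl fun x _ => ?_
    rcases le_total (p x) (q x) with h | h
    · rw [min_eq_left h, max_eq_right h]
    · rw [min_eq_right h, max_eq_left h, mul_comm]
  have h2 : ∑ x, max (p x) (q x) ≤ 2 := by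
    calc ∑ x, max (p x) (q x) ≤ ∑ x, (p x + q x) := Finset.sum_le_sum fun x _ =>
          max_le (le_add_of_nonneg_right (hq.1 x)) (le_add_of_nonneg_left (hp.1 x))
      _ = 2 := by rw [Finset.sum_add_distrib, hp.2, hq.2]; norm_num
  have h3 : 0 ≤ ∑ x, min (p x) (q x) := Finset.sum_nonneg fun x _ => le_min (hp.1 x) (hq.1 x)
  calc affinity p q ^ 2
      ≤ (∑ x, √(min (p x) (q x)) ^ 2) * ∑ x, √(max (p x) (q x)) ^ 2 := by
        rw [h1]; exact Finset.sum_mul_sq_le_sq_mul_sq _ _ _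
    _ = (∑ x, min (p x) (q x)) * ∑ x, max (p x) (q x) := by
        congr 1 <;> refine Finset.sum_congr rfl fun _ _ => Real.sq_sqrt ?_
        · exact le_min (hp.1 _) (hq.1 _)
        · exact (hp.1 _).trans (le_max_left _ _)
    _ ≤ 2 * ∑ x, min (p x) (q x) := by nlinarith

lemma affinity_nonneg (p q : X → ℝ) : 0 ≤ affinity p q :=
  Finset.sum_nonneg fun _ _ => mul_nonneg (Real.sqrt_nonneg _) (Real.sqrt_nonneg _)

lemma IsDist.prod {p : X → ℝ} (hp : IsDist p) (n : ℕ) :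
    IsDist fun x : Fin n → X => ∏ i, p (x i) :=
  ⟨fun x => hp.prod_nonneg x, hp.sum_prod_eq_one n⟩

lemma affinity_prod {p q : X → ℝ} (hp : IsDist p) (hq : IsDist q) (n : ℕ) :
    affinity (fun x : Fin n → X => ∏ i, p (x i)) (fun x => ∏ i, q (x i)) =
      affinity p q ^ n := by
  unfold affinity
  rw [Fintype.sum_pow]
  refine Finset.sum_congr rfl fun x _ => ?_
  rw [Finset.prod_mul_distrib, Real.sqrt_prod _ fun i _ => hp.1 _,
    Real.sqrt_prod _ fun i _ => hq.1 _]

/-- Le Cam two-point lower bound for the minimax error. -/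
lemma affinity_pow_le_eStar {S T : Set (X → ℝ)} (hS : ∀ P ∈ S, IsDist P)
    (hT : ∀ Q ∈ T, IsDist Q) {P Q : X → ℝ} (hP : P ∈ S) (hQ : Q ∈ T) (n : ℕ) :
    (affinity P Q ^ n) ^ 2 ≤ 2 * eStar S T n := by
  have key : (affinity P Q ^ n) ^ 2 / 2 ≤ eStar S T n := by
    refine le_ciInf fun φ => ?_
    have h1 := le_ciSup (bddAbove_expect hS fun x => (φ.2 x).2) ⟨P, hP⟩
    have h2 := le_ciSup (bddAbove_expect (φ := fun x => 1 - φ.1 x) hT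
      fun x => sub_le_self _ (φ.2 x).1) ⟨Q, hQ⟩
    have h3 := affinity_sq_le_two_mul_sum_min ((hS P hP).prod n) ((hT Q hQ).prod n)
    rw [affinity_prod (hS P hP) (hT Q hQ)] at h3
    have h4 : ∑ x : Fin n → X, min (∏ i, P (x i)) (∏ i, Q (x i)) ≤
        ∑ x : Fin n → X, (∏ i, P (x i)) * φ.1 x +
          ∑ x : Fin n → X, (∏ i, Q (x i)) * (1 - φ.1 x) := by
      rw [← Finset.sum_add_distrib]
      refine Finset.sum_le_sum fun x _ => ?_
      nlinarith [mul_le_mul_of_nonneg_right (min_le_left (∏ i, P (x i)) (∏ i, Q (x i)))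
        (φ.2 x).1, mul_le_mul_of_nonneg_right (min_le_right (∏ i, P (x i)) (∏ i, Q (x i)))
        (sub_nonneg.2 (φ.2 x).2)]
    have h5 := add_le_add h1 h2
    unfold errSum
    linarith
  linarith

lemma hellSq_eq {p q : X → ℝ} (hp : IsDist p) (hq : IsDist q) :
    hellSq p q = 2 - 2 * affinity p q := by
  unfold hellSq affinity
  have : ∀ x, (√(p x) - √(q x)) ^ 2 = p x + q x - 2 * (√(p x) * √(q x)) := fun x => by
    have h1 := Real.sq_sqrt (hp.1 x)
    have h2 := Real.sq_sqrt (hq.1 x)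
    linear_combination h1 + h2
  simp only [this]
  rw [Finset.sum_sub_distrib, Finset.sum_add_distrib, hp.2, hq.2, Finset.mul_sum]
  norm_num

lemma le_mul_hellSq_of_eStar_le {S T : Set (X → ℝ)} (hS : ∀ P ∈ S, IsDist P)
    (hT : ∀ Q ∈ T, IsDist Q) {P Q : X → ℝ} (hP : P ∈ S) (hQ : Q ∈ T) {n : ℕ}
    (hn : eStar S T n ≤ 1 / 10) : 4 / 5 ≤ n * hellSq P Q := by
  have h1 := affinity_pow_le_eStar hS hT hP hQ n
  have h2 := one_add_mul_le_pow (a := affinity P Q - 1)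
    (by linarith [affinity_nonneg P Q]) (n * 2)
  rw [add_sub_cancel, pow_mul] at h2
  push_cast at h2
  rw [hellSq_eq (hS P hP) (hT Q hQ)]
  linarith

/-- A ratio `r` with small moments under both hypotheses gives a product likelihood-ratio test. -/
lemma eStar_le_of_moment_bound {S T : Set (X → ℝ)} (hS : ∀ P ∈ S, IsDist P)
    (hT : ∀ Q ∈ T, IsDist Q) (hne : S.Nonempty) (hne' : T.Nonempty) {r : X → ℝ}
    (hr : ∀ x, 0 < r x) {ρ : ℝ} (hP : ∀ P ∈ S, ∑ x, P x * r x ≤ ρ)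
    (hQ : ∀ Q ∈ T, ∑ x, Q x * (r x)⁻¹ ≤ ρ) (n : ℕ) : eStar S T n ≤ 2 * ρ ^ n := by
  have hprod : ∀ x : Fin n → X, 0 < ∏ i, r (x i) := fun x =>
    Finset.prod_pos fun i _ => hr (x i)
  have hφ : ∀ x : Fin n → X, 0 ≤ (if 1 ≤ ∏ i, r (x i) then (1 : ℝ) else 0) ∧
      (if 1 ≤ ∏ i, r (x i) then (1 : ℝ) else 0) ≤ 1 := fun x => by
    split_ifs <;> norm_num
  refine (eStar_le_errSum hS hT hφ).trans ?_
  have := hne.to_subtype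
  have := hne'.to_subtype
  rw [two_mul]
  refine add_le_add (ciSup_le fun P => ?_) (ciSup_le fun Q => ?_)
  · calc _ ≤ ∑ x : Fin n → X, ∏ i, P.1 (x i) * r (x i) := by
          refine Finset.sum_le_sum fun x _ => ?_
          rw [Finset.prod_mul_distrib]
          refine mul_le_mul_of_nonneg_left ?_ ((hS P P.2).prod_nonneg x)
          dsimp only
          split_ifs with h
          · exact h
          · exact (hprod x).le
      _ = (∑ x, P.1 x * r x) ^ n := (Fintype.sum_pow (fun x => P.1 x * r x) n).symm
      _ ≤ ρ ^ n := pow_le_pow_left₀ (Finset.sum_nonneg fun x _ =>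
          mul_nonneg ((hS P P.2).1 x) (hr x).le) (hP P P.2) n
  · calc _ ≤ ∑ x : Fin n → X, ∏ i, Q.1 (x i) * (r (x i))⁻¹ := by
          refine Finset.sum_le_sum fun x _ => ?_
          rw [Finset.prod_mul_distrib, Finset.prod_inv_distrib]
          refine mul_le_mul_of_nonneg_left ?_ ((hT Q Q.2).prod_nonneg x)
          dsimp only
          split_ifs with h
          · simpa using (hprod x).le
          · simpa using (one_le_inv₀ (hprod x)).2 (not_le.1 h).le
      _ = (∑ x, Q.1 x * (r x)⁻¹) ^ n := (Fintype.sum_pow (fun x => Q.1 x * (r x)⁻¹) n).symm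
      _ ≤ ρ ^ n := pow_le_pow_left₀ (Finset.sum_nonneg fun x _ =>
          mul_nonneg ((hT Q Q.2).1 x) (inv_nonneg.2 (hr x).le)) (hQ Q Q.2) n

/-- First-order optimality of a maximizer of `P ↦ ∑ √(P + η) * w` over a convex set. -/
lemma sum_mul_div_le_of_isMaxOn {S : Set (X → ℝ)} (hS : ∀ P ∈ S, IsDist P) (hconv : Convex ℝ S)
    {η : ℝ} (hη : 0 < η) {w : X → ℝ} {P₀ : X → ℝ} (hP₀ : P₀ ∈ S)
    (hmax : ∀ P ∈ S, ∑ x, √(P x + η) * w x ≤ ∑ x, √(P₀ x + η) * w x)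
    {P : X → ℝ} (hP : P ∈ S) :
    ∑ x, (P x - P₀ x) * (w x / √(P₀ x + η)) ≤ 0 := by
  have hpos : ∀ P ∈ S, ∀ x, 0 < P x + η := fun P hP x => add_pos_of_nonneg_of_pos ((hS P hP).1 x) hη
  let f : ℝ → ℝ := fun t => ∑ x, (P x - P₀ x) * (w x /
    (√((P₀ x + t * (P x - P₀ x)) + η) + √(P₀ x + η)))
  have hf : ∀ t ∈ Set.Ioc (0 : ℝ) 1, f t ≤ 0 := by
    rintro t ⟨ht0, ht1⟩
    have hPt : (fun x => P₀ x + t * (P x - P₀ x)) ∈ S := by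
      have := hconv hP₀ hP (sub_nonneg.2 ht1) ht0.le (by ring)
      convert this using 1
      ext x
      simp only [Pi.add_apply, Pi.smul_apply, smul_eq_mul]
      ring
    have h := hmax _ hPt
    have h' : t * f t = ∑ x, √((P₀ x + t * (P x - P₀ x)) + η) * w x -
        ∑ x, √(P₀ x + η) * w x := by
      rw [Finset.mul_sum, ← Finset.sum_sub_distrib]
      refine Finset.sum_congr rfl fun x _ => ?_
      have ha := hpos _ hPt x
      have hb := hpos _ hP₀ x
      have ha' := Real.sq_sqrt ha.le
      have hb' := Real.sq_sqrt hb.le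
      have hs : 0 < √((P₀ x + t * (P x - P₀ x)) + η) + √(P₀ x + η) :=
        add_pos (Real.sqrt_pos.2 ha) (Real.sqrt_pos.2 hb)
      field_simp
      linear_combination w x * (hb' - ha')
    by_contra! hc
    have := mul_pos ht0 hc
    linarith
  have hcont : ContinuousAt f 0 := by
    refine tendsto_finsetSum _ fun x _ => ?_
    have hb := Real.sqrt_pos.2 (hpos _ hP₀ x)
    have : ContinuousAt (fun t : ℝ => (P x - P₀ x) * (w x /
        (√((P₀ x + t * (P x - P₀ x)) + η) + √(P₀ x + η)))) 0 := by
      refine ContinuousAt.mul continuousAt_const (ContinuousAt.div continuousAt_const ?_ ?_)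
      · fun_prop
      · positivity
    exact this
  have hlim : Filter.Tendsto f (nhdsWithin 0 (Set.Ioi 0)) (nhds (f 0)) :=
    hcont.tendsto.mono_left nhdsWithin_le_nhds
  have h0 : f 0 ≤ 0 := le_of_tendsto hlim <| by
    filter_upwards [Ioc_mem_nhdsGT (zero_lt_one' ℝ)] with t ht using hf t ht
  have h2 : ∑ x, (P x - P₀ x) * (w x / √(P₀ x + η)) = 2 * f 0 := by
    rw [Finset.mul_sum]
    refine Finset.sum_congr rfl fun x _ => ?_
    have hb := Real.sqrt_pos.2 (hpos _ hP₀ x)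
    simp only [zero_mul, add_zero]
    field_simp
    ring
  linarith

lemma sum_mul_div_le_smoothed_affinity {S : Set (X → ℝ)} (hS : ∀ P ∈ S, IsDist P)
    (hconv : Convex ℝ S) {η : ℝ} (hη : 0 < η) {w : X → ℝ} (hw : ∀ x, 0 ≤ w x)
    {P₀ : X → ℝ} (hP₀ : P₀ ∈ S)
    (hmax : ∀ P ∈ S, ∑ x, √(P x + η) * w x ≤ ∑ x, √(P₀ x + η) * w x)
    {P : X → ℝ} (hP : P ∈ S) :
    ∑ x, P x * (w x / √(P₀ x + η)) ≤ ∑ x, √(P₀ x + η) * w x := by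
  have h := sum_mul_div_le_of_isMaxOn hS hconv hη hP₀ hmax hP
  simp only [sub_mul, Finset.sum_sub_distrib] at h
  refine (sub_nonpos.1 h).trans (Finset.sum_le_sum fun x _ => ?_)
  have hpos : 0 < P₀ x + η := add_pos_of_nonneg_of_pos ((hS P₀ hP₀).1 x) hη
  have hb := Real.sqrt_pos.2 hpos
  have hb' := Real.sq_sqrt hpos.le
  rw [← mul_div_assoc, div_le_iff₀ hb]
  nlinarith [mul_nonneg hη.le (hw x)]

/-- Le Cam–Birgé: compact convex hypotheses with uniformly bounded Hellinger affinity can be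
tested with exponentially small error. -/
lemma eStar_le_of_affinity_le {S T : Set (X → ℝ)} (hS : ∀ P ∈ S, IsDist P)
    (hT : ∀ Q ∈ T, IsDist Q) (hne : S.Nonempty) (hne' : T.Nonempty) (hSc : Convex ℝ S)
    (hTc : Convex ℝ T) (hSk : IsCompact S) (hTk : IsCompact T) {ρ γ : ℝ} (hγ : 0 < γ)
    (hρ : ∀ P ∈ S, ∀ Q ∈ T, affinity P Q ≤ ρ) (n : ℕ) :
    eStar S T n ≤ 2 * (ρ + γ) ^ n := by
  set N : ℝ := 3 * (Fintype.card X + 1) with hN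
  have hNpos : 0 < N := by positivity
  set e : ℝ := min 1 (γ / N) with he
  have he0 : 0 < e := lt_min one_pos (div_pos hγ hNpos)
  have he1 : e ≤ 1 := min_le_left _ _
  have heγ : e * N ≤ γ := (le_div_iff₀ hNpos).1 (min_le_right _ _)
  have hη : 0 < e ^ 2 := by positivity
  let F : (X → ℝ) × (X → ℝ) → ℝ := fun z => ∑ x, √(z.1 x + e ^ 2) * √(z.2 x + e ^ 2)
  have hF : Continuous F := by fun_prop
  obtain ⟨⟨P₀, Q₀⟩, ⟨hP₀, hQ₀⟩, hmax⟩ :=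
    (hSk.prod hTk).exists_isMaxOn (hne.prod hne') hF.continuousOn
  have hsqrt : ∀ a : ℝ, 0 ≤ a → √(a + e ^ 2) ≤ √a + e := fun a ha => by
    refine Real.sqrt_le_iff.2 ⟨by positivity, ?_⟩
    nlinarith [Real.sq_sqrt ha, mul_nonneg (Real.sqrt_nonneg a) he0.le]
  have hF₀ : F (P₀, Q₀) ≤ ρ + γ := by
    have h1 : F (P₀, Q₀) ≤ ∑ x, (√(P₀ x) * √(Q₀ x) + 3 * e) := by
      refine Finset.sum_le_sum fun x _ => ?_
      have hp1 : √(P₀ x) ≤ 1 := Real.sqrt_le_one.2 ((hS P₀ hP₀).le_one x)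
      have hq1 : √(Q₀ x) ≤ 1 := Real.sqrt_le_one.2 ((hT Q₀ hQ₀).le_one x)
      calc √(P₀ x + e ^ 2) * √(Q₀ x + e ^ 2)
          ≤ (√(P₀ x) + e) * (√(Q₀ x) + e) :=
            mul_le_mul (hsqrt _ ((hS P₀ hP₀).1 x)) (hsqrt _ ((hT Q₀ hQ₀).1 x))
              (Real.sqrt_nonneg _) (by positivity)
        _ ≤ √(P₀ x) * √(Q₀ x) + 3 * e := by nlinarith
    rw [Finset.sum_add_distrib, Finset.sum_const, Finset.card_univ, nsmul_eq_mul] at h1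
    have h2 := hρ P₀ hP₀ Q₀ hQ₀
    unfold affinity at h2
    nlinarith
  have hpos : ∀ x, 0 < √(P₀ x + e ^ 2) := fun x =>
    Real.sqrt_pos.2 (add_pos_of_nonneg_of_pos ((hS P₀ hP₀).1 x) hη)
  have hpos' : ∀ x, 0 < √(Q₀ x + e ^ 2) := fun x =>
    Real.sqrt_pos.2 (add_pos_of_nonneg_of_pos ((hT Q₀ hQ₀).1 x) hη)
  refine eStar_le_of_moment_bound hS hT hne hne'
    (r := fun x => √(Q₀ x + e ^ 2) / √(P₀ x + e ^ 2))
    (fun x => div_pos (hpos' x) (hpos x)) (fun P hP => ?_) (fun Q hQ => ?_) n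
  · exact (sum_mul_div_le_smoothed_affinity hS hSc hη (fun x => (hpos' x).le) hP₀
      (fun P hP => hmax (Set.mk_mem_prod hP hQ₀)) hP).trans hF₀
  · simp only [inv_div]
    refine (sum_mul_div_le_smoothed_affinity hT hTc hη (fun x => (hpos x).le) hQ₀
      (fun Q hQ => ?_) hQ).trans ?_
    · have h : F (P₀, Q) ≤ F (P₀, Q₀) := hmax (Set.mk_mem_prod hP₀ hQ)
      simpa only [F, mul_comm] using h
    · simpa only [F, mul_comm] using hF₀

end Tests

section UncertaintySets

variable {X : Type*} [Fintype X]

lemma IsDist.mem_PTV {p : X → ℝ} (hp : IsDist p) {ε : ℝ} (hε : 0 ≤ ε) : p ∈ PTV p ε :=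
  ⟨hp, by simpa [dTV] using hε⟩

lemma IsDist.mem_PSub {p : X → ℝ} (hp : IsDist p) {ε : ℝ} (hε : 0 ≤ ε) : p ∈ PSub p ε :=
  ⟨hp, fun x => le_mul_of_one_le_left (hp.1 x) (le_add_of_nonneg_right hε)⟩

lemma dTV_eq_sum_posPart {p q : X → ℝ} (hp : IsDist p) (hq : IsDist q) :
    dTV p q = ∑ x, max (p x - q x) 0 := by
  have h : ∀ x, |p x - q x| = 2 * max (p x - q x) 0 - (p x - q x) := fun x => by
    rcases le_total (p x - q x) 0 with h | h
    · rw [abs_of_nonpos h, max_eq_right h]; ring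
    · rw [abs_of_nonneg h, max_eq_left h]; ring
  unfold dTV
  simp only [h]
  rw [Finset.sum_sub_distrib, Finset.sum_sub_distrib, hp.2, hq.2, ← Finset.mul_sum]
  ring

lemma PSub_subset_PTV {p : X → ℝ} (hp : IsDist p) {ε : ℝ} (hε : 0 ≤ ε) :
    PSub p ε ⊆ PTV p ε := by
  rintro P ⟨hP, h⟩
  refine ⟨hP, ?_⟩
  rw [dTV_eq_sum_posPart hP hp]
  calc ∑ x, max (P x - p x) 0 ≤ ∑ x, ε * p x := Finset.sum_le_sum fun x _ =>
        max_le (by linarith [h x]) (mul_nonneg hε (hp.1 x))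
    _ = ε := by rw [← Finset.mul_sum, hp.2, mul_one]

lemma convex_PTV (p : X → ℝ) (ε : ℝ) : Convex ℝ (PTV p ε) := by
  rintro P ⟨hP, hPd⟩ Q ⟨hQ, hQd⟩ a b ha hb hab
  refine ⟨⟨fun x => ?_, ?_⟩, ?_⟩
  · exact add_nonneg (mul_nonneg ha (hP.1 x)) (mul_nonneg hb (hQ.1 x))
  · simp only [Pi.add_apply, Pi.smul_apply, smul_eq_mul]
    rw [Finset.sum_add_distrib, ← Finset.mul_sum, ← Finset.mul_sum, hP.2, hQ.2]
    linarith
  · have h : dTV (a • P + b • Q) p ≤ a * dTV P p + b * dTV Q p := by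
      have h1 : ∑ x, |(a • P + b • Q) x - p x| ≤
          ∑ x, (a * |P x - p x| + b * |Q x - p x|) := by
        refine Finset.sum_le_sum fun x _ => ?_
        have : (a • P + b • Q) x - p x = a * (P x - p x) + b * (Q x - p x) := by
          simp only [Pi.add_apply, Pi.smul_apply, smul_eq_mul]
          linear_combination p x * hab
        rw [this]
        refine (abs_add_le _ _).trans_eq ?_
        rw [abs_mul, abs_mul, abs_of_nonneg ha, abs_of_nonneg hb]
      rw [Finset.sum_add_distrib, ← Finset.mul_sum, ← Finset.mul_sum] at h1
      unfold dTV
      linarith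
    calc dTV (a • P + b • Q) p ≤ a * dTV P p + b * dTV Q p := h
      _ ≤ a * ε + b * ε := add_le_add (mul_le_mul_of_nonneg_left hPd ha)
          (mul_le_mul_of_nonneg_left hQd hb)
      _ = ε := by rw [← add_mul, hab, one_mul]

lemma isCompact_PTV (p : X → ℝ) (ε : ℝ) : IsCompact (PTV p ε) := by
  have hsub : PTV p ε ⊆ Set.Icc (fun _ => (0 : ℝ)) (fun _ => 1) := fun P hP =>
    ⟨hP.1.1, hP.1.le_one⟩
  refine isCompact_Icc.of_isClosed_subset ?_ hsub
  have h1 : IsClosed {P : X → ℝ | ∀ x, 0 ≤ P x} := by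
    simp only [Set.ofPred_forall]
    exact isClosed_iInter fun x => isClosed_le continuous_const (continuous_apply x)
  have h2 : IsClosed {P : X → ℝ | ∑ x, P x = 1} :=
    isClosed_eq (by fun_prop) continuous_const
  have h3 : IsClosed {P : X → ℝ | dTV P p ≤ ε} := by
    unfold dTV
    exact isClosed_le (by fun_prop) continuous_const
  exact (h1.inter h2).inter h3

/-- Shrink two masses `a, b` below `c, d` while controlling both the removed mass and the
Hellinger discrepancy. -/
lemma exists_shrink {δ κ : ℝ} (hδ : 0 < δ) (hκ : κ = (1 - (√(1 + δ))⁻¹) ^ 2) {a b c d : ℝ}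
    (ha : 0 ≤ a) (hb : 0 ≤ b) (hc : 0 ≤ c) (hd : 0 ≤ d) :
    ∃ u v : ℝ, 0 ≤ u ∧ 0 ≤ v ∧ u ≤ c ∧ v ≤ d ∧
      a - u ≤ max (a - c) 0 + (1 + δ) * max (b - d) 0 ∧
      b - v ≤ max (b - d) 0 + (1 + δ) * max (a - c) 0 ∧
      κ * (√u - √v) ^ 2 ≤ (√a - √b) ^ 2 := by
  have hw : 1 < √(1 + δ) := Real.lt_sqrt_of_sq_lt (by linarith)
  have hw0 : 0 < (√(1 + δ))⁻¹ := by positivity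
  have hw1 : (√(1 + δ))⁻¹ < 1 := inv_lt_one_of_one_lt₀ hw
  have hκ1 : κ ≤ 1 := by rw [hκ]; nlinarith
  have hκ0 : 0 ≤ κ := by rw [hκ]; positivity
  have hm1 : 0 ≤ (1 + δ) * max (b - d) 0 := mul_nonneg (by linarith) (le_max_right _ _)
  have hm2 : 0 ≤ (1 + δ) * max (a - c) 0 := mul_nonneg (by linarith) (le_max_right _ _)
  have far : ∀ {s t u v : ℝ}, 0 ≤ s → 0 ≤ t → 0 ≤ u → 0 ≤ v → (1 + δ) * t < s → u ≤ s → v ≤ t →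
      κ * (√u - √v) ^ 2 ≤ (√s - √t) ^ 2 := by
    intro s t u v hs ht hu hv hst hus hvt
    have h1 : √(1 + δ) * √t ≤ √s := by
      rw [← Real.sqrt_mul (by linarith)]; exact Real.sqrt_le_sqrt hst.le
    have h2 : √t ≤ (√(1 + δ))⁻¹ * √s := by
      rw [inv_mul_eq_div, le_div_iff₀ (by positivity)]; linarith
    have h3 : (1 - (√(1 + δ))⁻¹) * √s ≤ √s - √t := by linarith
    have h4 : κ * √s ^ 2 ≤ (√s - √t) ^ 2 := by
      rw [hκ, ← mul_pow]
      exact pow_le_pow_left₀ (mul_nonneg (by linarith) (Real.sqrt_nonneg _)) h3 2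
    have h5 : (√u - √v) ^ 2 ≤ √s ^ 2 := by
      have := Real.sqrt_le_sqrt hus
      have := Real.sqrt_le_sqrt (hvt.trans (by nlinarith : t ≤ s))
      have := Real.sqrt_nonneg u
      have := Real.sqrt_nonneg v
      exact sq_le_sq' (by linarith) (by linarith)
    exact (mul_le_mul_of_nonneg_left h5 hκ0).trans h4
  have hmin : ∀ s t : ℝ, s - min s t = max (s - t) 0 := fun s t => by
    rcases le_total s t with h | h
    · rw [min_eq_left h, max_eq_right (by linarith)]; ring
    · rw [min_eq_right h, max_eq_left (by linarith)]
  by_cases hfar : (1 + δ) * b < a ∨ (1 + δ) * a < b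
  · refine ⟨min a c, min b d, le_min ha hc, le_min hb hd, min_le_right _ _, min_le_right _ _,
      ?_, ?_, ?_⟩
    · rw [hmin]; linarith
    · rw [hmin]; linarith
    · rcases hfar with h | h
      · exact far ha hb (le_min ha hc) (le_min hb hd) h (min_le_left _ _) (min_le_left _ _)
      · rw [← neg_sub √b, neg_sq, ← neg_sub √(min b d), neg_sq]
        exact far hb ha (le_min hb hd) (le_min ha hc) h (min_le_left _ _) (min_le_left _ _)
  · push Not at hfar
    obtain ⟨hab, hba⟩ := hfar
    have hscale : ∃ t : ℝ, 0 ≤ t ∧ t ≤ 1 ∧ t * a ≤ c ∧ t * b ≤ d ∧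
        (t = 1 ∨ t * a = c ∨ t * b = d) := by
      rcases ha.eq_or_lt with rfl | ha'
      · have : b = 0 := le_antisymm (by linarith) hb
        subst this
        exact ⟨1, zero_le_one, le_rfl, by simpa, by simpa, Or.inl rfl⟩
      · have hb' : 0 < b := by nlinarith
        refine ⟨min 1 (min (c / a) (d / b)), by positivity, min_le_left _ _, ?_, ?_, ?_⟩
        · rw [← le_div_iff₀ ha']; exact (min_le_right _ _).trans (min_le_left _ _)
        · rw [← le_div_iff₀ hb']; exact (min_le_right _ _).trans (min_le_right _ _)
        · rcases min_choice 1 (min (c / a) (d / b)) with h | h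
          · exact Or.inl h
          · rcases min_choice (c / a) (d / b) with h' | h'
            · right; left; rw [h, h']; field_simp
            · right; right; rw [h, h']; field_simp
    obtain ⟨t, ht0, ht1, hta, htb, ht⟩ := hscale
    have hx := le_max_left (a - c) 0
    have hx' := le_max_right (a - c) 0
    have hy := le_max_left (b - d) 0
    have hy' := le_max_right (b - d) 0
    refine ⟨t * a, t * b, mul_nonneg ht0 ha, mul_nonneg ht0 hb, hta, htb, ?_, ?_, ?_⟩
    · rcases ht with rfl | rfl | rfl
      · linarith
      · linarith
      · have : (1 - t) * a ≤ (1 - t) * ((1 + δ) * b) :=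
          mul_le_mul_of_nonneg_left hab (by linarith)
        have : (1 + δ) * (b - t * b) ≤ (1 + δ) * max (b - t * b) 0 :=
          mul_le_mul_of_nonneg_left hy (by linarith)
        linarith
    · rcases ht with rfl | rfl | rfl
      · linarith
      · have : (1 - t) * b ≤ (1 - t) * ((1 + δ) * a) :=
          mul_le_mul_of_nonneg_left hba (by linarith)
        have : (1 + δ) * (a - t * a) ≤ (1 + δ) * max (a - t * a) 0 :=
          mul_le_mul_of_nonneg_left hx (by linarith)
        linarith
      · linarith
    · rw [Real.sqrt_mul ht0, Real.sqrt_mul ht0, ← mul_sub, mul_pow, Real.sq_sqrt ht0, ← mul_assoc]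
      exact mul_le_of_le_one_left (sq_nonneg _) (mul_le_one₀ hκ1 ht0 ht1)

/-- Normalizing two subprobability vectors of mass at least `1/2` at most doubles `hellSq`. -/
lemma hellSq_normalize_le {u v : X → ℝ} (hu : ∀ x, 0 ≤ u x) (hv : ∀ x, 0 ≤ v x)
    (hu' : 1 / 2 ≤ ∑ x, u x) (hv' : 1 / 2 ≤ ∑ x, v x) :
    hellSq (fun x => u x / ∑ y, u y) (fun x => v x / ∑ y, v y) ≤ 2 * hellSq u v := by
  set A := ∑ y, u y with hA
  set B := ∑ y, v y with hB
  have hA0 : 0 < √A := Real.sqrt_pos.2 (by linarith)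
  have hB0 : 0 < √B := Real.sqrt_pos.2 (by linarith)
  have hA2 : √A ^ 2 = A := Real.sq_sqrt (by linarith)
  have hB2 : √B ^ 2 = B := Real.sq_sqrt (by linarith)
  have hdu : IsDist fun x => u x / A :=
    ⟨fun x => div_nonneg (hu x) (by linarith), by
      rw [← Finset.sum_div, div_self (by linarith)]⟩
  have hdv : IsDist fun x => v x / B :=
    ⟨fun x => div_nonneg (hv x) (by linarith), by
      rw [← Finset.sum_div, div_self (by linarith)]⟩
  have h1 : affinity (fun x => u x / A) (fun x => v x / B) = affinity u v / (√A * √B) := by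
    unfold affinity
    rw [Finset.sum_div]
    refine Finset.sum_congr rfl fun x _ => ?_
    rw [Real.sqrt_div (hu x), Real.sqrt_div (hv x), div_mul_div_comm]
  have h2 : hellSq u v = A + B - 2 * affinity u v := by
    unfold hellSq affinity
    rw [hA, hB, Finset.mul_sum, ← Finset.sum_add_distrib, ← Finset.sum_sub_distrib]
    refine Finset.sum_congr rfl fun x _ => ?_
    linear_combination Real.sq_sqrt (hu x) + Real.sq_sqrt (hv x)
  have h3 : 1 / 2 ≤ √A * √B := by
    rw [← Real.sqrt_mul (by linarith)]
    refine Real.le_sqrt_of_sq_le ?_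
    nlinarith
  have h4 : 0 ≤ hellSq u v := Finset.sum_nonneg fun x _ => sq_nonneg _
  rw [hellSq_eq hdu hdv, h1]
  have h5 : 2 - 2 * (affinity u v / (√A * √B)) =
      (2 * (√A * √B) - 2 * affinity u v) / (√A * √B) := by
    field_simp
  rw [h5, div_le_iff₀ (by positivity)]
  nlinarith [sq_nonneg (√A - √B)]

/-- Every pair from the TV balls is dominated, in Hellinger distance, by a pair from slightly
more than twice larger subtractive sets. -/
lemma exists_PSub_hellSq_le {δ κ : ℝ} (hδ : 0 < δ) (hκ : κ = (1 - (√(1 + δ))⁻¹) ^ 2)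
    {ε ε' : ℝ} (hε' : 0 ≤ ε') (hhalf : (2 + δ) * ε ≤ 1 / 2)
    (hle : 1 ≤ (1 + ε') * (1 - (2 + δ) * ε)) {p q P Q : X → ℝ} (hp : IsDist p) (hq : IsDist q)
    (hP : P ∈ PTV p ε) (hQ : Q ∈ PTV q ε) :
    ∃ P' ∈ PSub p ε', ∃ Q' ∈ PSub q ε', κ * hellSq P' Q' ≤ 2 * hellSq P Q := by
  choose u v hu hv huc hvd hmu hmv hh using fun x =>
    exists_shrink hδ hκ (hP.1.1 x) (hQ.1.1 x) (hp.1 x) (hq.1 x)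
  have hPd := hP.2
  have hQd := hQ.2
  rw [dTV_eq_sum_posPart hP.1 hp] at hPd
  rw [dTV_eq_sum_posPart hQ.1 hq] at hQd
  have hA : 1 - (2 + δ) * ε ≤ ∑ x, u x := by
    have := Finset.sum_le_sum fun x (_ : x ∈ Finset.univ) => hmu x
    rw [Finset.sum_sub_distrib, Finset.sum_add_distrib, ← Finset.mul_sum, hP.1.2] at this
    nlinarith
  have hB : 1 - (2 + δ) * ε ≤ ∑ x, v x := by
    have := Finset.sum_le_sum fun x (_ : x ∈ Finset.univ) => hmv x
    rw [Finset.sum_sub_distrib, Finset.sum_add_distrib, ← Finset.mul_sum, hQ.1.2] at this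
    nlinarith
  have mem : ∀ {r w : X → ℝ}, IsDist r → (∀ x, 0 ≤ w x) → (∀ x, w x ≤ r x) →
      1 - (2 + δ) * ε ≤ ∑ x, w x → (fun x => w x / ∑ y, w y) ∈ PSub r ε' := by
    intro r w hr hw hwr hW
    have hW0 : 0 < ∑ x, w x := by linarith
    refine ⟨⟨fun x => div_nonneg (hw x) hW0.le, by
      rw [← Finset.sum_div, div_self hW0.ne']⟩, fun x => ?_⟩
    rw [div_le_iff₀ hW0]
    have h1 : 1 ≤ (1 + ε') * ∑ y, w y :=
      hle.trans (mul_le_mul_of_nonneg_left hW (by linarith))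
    calc w x ≤ r x := hwr x
      _ ≤ ((1 + ε') * ∑ y, w y) * r x := le_mul_of_one_le_left (hr.1 x) h1
      _ = (1 + ε') * r x * ∑ y, w y := by ring
  refine ⟨_, mem hp hu huc hA, _, mem hq hv hvd hB, ?_⟩
  have hκ0 : 0 ≤ κ := by rw [hκ]; positivity
  have h1 := hellSq_normalize_le hu hv (by linarith) (by linarith)
  have h2 : κ * hellSq u v ≤ hellSq P Q := by
    unfold hellSq
    rw [Finset.mul_sum]
    exact Finset.sum_le_sum fun x _ => hh x
  nlinarith

end UncertaintySets

/-- Sandwich bounds between the subtractive and TV sample complexities: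
`n*_Sub(ε) ≤ n*_TV(ε) ≲ n*_Sub((2+δ₀)ε)`. -/
theorem sub_tv_sandwich (δ₀ : ℝ) (hδ₀ : 0 < δ₀) :
    ∃ C εbar : ℝ, 0 < C ∧ 0 < εbar ∧
      ∀ (X : Type) [Fintype X] [Nonempty X] (p q : X → ℝ),
        IsDist p → IsDist q →
        ∀ ε : ℝ, 0 < ε → ε ≤ dTV p q / 4 → ε ≤ εbar → (2 + δ₀) * ε < 1 →
          nStar (PSub p ε) (PSub q ε) ≤ nStar (PTV p ε) (PTV q ε) ∧
          nStar (PTV p ε) (PTV q ε) ≤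
            ENNReal.ofReal C *
              nStar (PSub p ((2 + δ₀) * ε)) (PSub q ((2 + δ₀) * ε)) := by
  set δ := δ₀ / 2 with hδdef
  have hδ : 0 < δ := by positivity
  set κ := (1 - (√(1 + δ))⁻¹) ^ 2 with hκ
  have hw : 1 < √(1 + δ) := Real.lt_sqrt_of_sq_lt (by linarith)
  have hκ0 : 0 < κ := pow_pos (sub_pos.2 (inv_lt_one_of_one_lt₀ hw)) 2
  set K := ⌈40 / κ⌉₊ with hK
  have hKpos : 0 < K := Nat.ceil_pos.2 (by positivity)
  have hKκ : 40 ≤ K * κ := (div_le_iff₀ hκ0).1 (Nat.le_ceil _)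
  refine ⟨K, δ₀ / (2 * (2 + δ₀) ^ 2), by exact_mod_cast hKpos, by positivity, ?_⟩
  intro X _ _ p q hp hq ε hε _ hεbar _
  refine ⟨nStar_mono (fun P hP => hP.1) (fun Q hQ => hQ.1) ⟨p, hp.mem_PSub hε.le⟩
    ⟨q, hq.mem_PSub hε.le⟩ (PSub_subset_PTV hp hε.le) (PSub_subset_PTV hq hε.le), ?_⟩
  rw [ENNReal.ofReal_natCast]
  rw [le_div_iff₀ (by positivity)] at hεbar
  have hδε : 0 < δ₀ * ε := by positivity
  have hδε' : 0 < δ₀ ^ 2 * ε := by positivity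
  have hε' : 0 ≤ (2 + δ₀) * ε := by positivity
  have hhalf : (2 + δ) * ε ≤ 1 / 2 := by
    have h : ε * (2 * (2 + δ₀)) ≤ 1 := by
      by_contra! hc
      nlinarith [mul_pos (sub_pos.2 hc) (by positivity : 0 < 2 + δ₀)]
    rw [hδdef]; nlinarith
  have hle : 1 ≤ (1 + (2 + δ₀) * ε) * (1 - (2 + δ) * ε) := by
    rw [hδdef]
    have h : (2 + δ₀ / 2) * (2 + δ₀) * ε ≤ δ₀ / 2 := by nlinarith
    nlinarith [mul_le_mul_of_nonneg_right h hε.le]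
  have key : ∀ n : ℕ, eStar (PSub p ((2 + δ₀) * ε)) (PSub q ((2 + δ₀) * ε)) n ≤ 1 / 10 →
      nStar (PTV p ε) (PTV q ε) ≤ K * (n : ℝ≥0∞) := by
    intro n hn
    refine sInf_le ⟨K * n, by push_cast; rfl, ?_⟩
    have hell : ∀ P ∈ PTV p ε, ∀ Q ∈ PTV q ε, 2 / 5 * κ ≤ n * hellSq P Q := by
      intro P hP Q hQ
      obtain ⟨P', hP', Q', hQ', h⟩ := exists_PSub_hellSq_le hδ hκ hε' hhalf hle hp hq hP hQ
      have h1 := le_mul_hellSq_of_eStar_le (fun P hP => hP.1) (fun Q hQ => hQ.1) hP' hQ' hn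
      have h2 := mul_le_mul_of_nonneg_left h n.cast_nonneg
      nlinarith [mul_le_mul_of_nonneg_left h1 hκ0.le]
    have hn0 : (0 : ℝ) < n := by
      have h := hell p (hp.mem_PTV hε.le) q (hq.mem_PTV hε.le)
      rcases (n.cast_nonneg : (0 : ℝ) ≤ n).eq_or_lt with h0 | h0
      · rw [← h0] at h; linarith
      · exact h0
    have haff : ∀ P ∈ PTV p ε, ∀ Q ∈ PTV q ε, affinity P Q ≤ 1 - κ / (5 * n) := by
      intro P hP Q hQ
      have h := hell P hP Q hQ
      rw [hellSq_eq hP.1 hQ.1] at h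
      have : κ / (5 * n) ≤ 1 - affinity P Q := by
        rw [div_le_iff₀ (by positivity)]
        linarith
      linarith
    have hbound := eStar_le_of_affinity_le (fun P hP => hP.1) (fun Q hQ => hQ.1)
      ⟨p, hp.mem_PTV hε.le⟩ ⟨q, hq.mem_PTV hε.le⟩ (convex_PTV p ε) (convex_PTV q ε)
      (isCompact_PTV p ε) (isCompact_PTV q ε) (γ := κ / (10 * n)) (by positivity) haff (K * n)
    have hbase : 1 - κ / (5 * n) + κ / (10 * n) = 1 - κ / (10 * n) := by
      field_simp; ring
    have hnonneg : 0 ≤ 1 - κ / (10 * n) := by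
      rw [← hbase]
      have := (affinity_nonneg p q).trans
        (haff p (hp.mem_PTV hε.le) q (hq.mem_PTV hε.le))
      positivity
    rw [hbase] at hbound
    have hexp : (1 - κ / (10 * n)) ^ (K * n) ≤ Real.exp (-4) := by
      calc (1 - κ / (10 * n)) ^ (K * n) ≤ Real.exp (-(κ / (10 * n))) ^ (K * n) :=
            pow_le_pow_left₀ hnonneg (Real.one_sub_le_exp_neg _) _
        _ = Real.exp (-(K * κ / 10)) := by
            rw [← Real.exp_nat_mul]
            congr 1
            push_cast
            field_simp
        _ ≤ Real.exp (-4) := Real.exp_le_exp.2 (by linarith)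
    have hexp4 : Real.exp (-4) ≤ 1 / 20 := by
      rw [Real.exp_neg, ← one_div]
      refine one_div_le_one_div_of_le (by norm_num) ?_
      have h1 : (2.7 : ℝ) ≤ Real.exp 1 := by linarith [Real.exp_one_gt_d9]
      have h2 : Real.exp 4 = Real.exp 1 ^ 4 := by rw [← Real.exp_nat_mul]; norm_num
      rw [h2]
      exact le_trans (by norm_num) (pow_le_pow_left₀ (by norm_num) h1 4)
    linarith
  have hK0 : (K : ℝ≥0∞) ≠ 0 := by exact_mod_cast hKpos.ne'
  have hKtop : (K : ℝ≥0∞) ≠ ⊤ := ENNReal.natCast_ne_top K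
  rw [mul_comm, ← ENNReal.div_le_iff hK0 hKtop]
  refine le_sInf ?_
  rintro _ ⟨n, rfl, hn⟩
  rw [ENNReal.div_le_iff hK0 hKtop, mul_comm]
  exact key n hn

end
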